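/- arXiv:2507.05628 — 3 statements merged into one kernel-verified Lean document; each statement's English description precedes it below -/
import Mathlib

section
/- As ε → 0, θ̂_ε → θ₀ almost surely in ℝᵖ, μ_{θ̂_ε} → μ₀ almost surely in M(T) (total variation norm), and 𝒦μ_{θ̂_ε} → h₀ almost surely in C(T) (sup norm). -/
open Filter MeasureTheory ProbabilityTheory Topology

noncomputable section

/-- If `D` is continuous on a compact set `s` and `x₀` is its only zero there, then any `s`-valued
function along which `D` tends to zero converges to `x₀`. -/
theorem tendsto_of_tendsto_zero_of_unique_zero {ι X : Type*} [TopologicalSpace X] {s : Set X}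
    (hs : IsCompact s) {D : X → ℝ} (hD : ContinuousOn D s) {x₀ : X}
    (huniq : ∀ x ∈ s, D x = 0 → x = x₀) {l : Filter ι} {f : ι → X}
    (hf : ∀ᶠ i in l, f i ∈ s) (hlim : Tendsto (fun i => D (f i)) l (𝓝 0)) :
    Tendsto f l (𝓝 x₀) := by
  refine hs.tendsto_nhds_of_unique_mapClusterPt hf fun y hy hcl => huniq y hy ?_
  have hne : (𝓝 y ⊓ map f l).NeBot := hcl
  have hle : 𝓝 y ⊓ map f l ≤ 𝓝[s] y := inf_le_inf_left _ (le_principal_iff.2 hf)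
  exact tendsto_nhds_unique ((hD y hy).mono_left hle)
    ((tendsto_map'_iff.2 hlim).mono_left inf_le_right)

/-- A positive-semidefinite symmetric operator from the dual of a real normed space into the space
vanishes wherever its quadratic form does. -/
theorem apply_eq_zero_of_quadratic_eq_zero {E : Type*} [NormedAddCommGroup E] [NormedSpace ℝ E]
    (A : (E →L[ℝ] ℝ) →L[ℝ] E) (hpos : ∀ μ : E →L[ℝ] ℝ, 0 ≤ μ (A μ))
    (hsym : ∀ μ ν : E →L[ℝ] ℝ, μ (A ν) = ν (A μ)) {μ : E →L[ℝ] ℝ} (hμ : μ (A μ) = 0) :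
    A μ = 0 := by
  refine SeparatingDual.eq_zero_of_forall_dual_eq_zero (R := ℝ) fun ν => ?_
  have hquad : ∀ t : ℝ, 0 ≤ ν (A ν) * (t * t) + 2 * ν (A μ) * t + 0 := fun t => by
    have h := hpos (μ + t • ν)
    simp only [map_add, map_smul, add_apply, smul_apply,
      smul_eq_mul, hμ, hsym μ ν] at h
    linarith
  have hdisc := discrim_le_zero hquad
  unfold discrim at hdisc
  nlinarith [sq_nonneg (ν (A μ))]

/-- Theorem 3.10, consistency of the parametric MLE under continuous
observation.  `Z` is a centered Gaussian random element of `C([a,b])` with covariance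
operator `Kop`, `X^ε = 𝒦μ_{θ₀} + εZ`, `Θ ⊂ ℝᵖ` is compact, `θ ↦ μ_θ` is continuous,
identifiability holds, and `θ̂_ε` maximizes `Φ_ε(θ) = ⟨μ_θ, X^ε⟩ − ½⟨μ_θ, 𝒦μ_θ⟩` over `Θ`.
Then, almost surely, as `ε → 0`: `θ̂_ε → θ₀` in `ℝᵖ`, `μ_{θ̂_ε} → μ_{θ₀}` in `M(T)`
(total variation norm), and `𝒦μ_{θ̂_ε} → h₀ = 𝒦μ_{θ₀}` in `C(T)` (sup norm). -/
theorem stmt4 {a b : ℝ} (hab : a < b) {p : ℕ}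
    {Ω : Type*} [MeasurableSpace Ω] (P : Measure Ω) [IsProbabilityMeasure P]
    (K : C(Set.Icc a b × Set.Icc a b, ℝ))
    (hKsymm : ∀ s t : Set.Icc a b, K (s, t) = K (t, s))
    (Kop : (C(Set.Icc a b, ℝ) →L[ℝ] ℝ) →L[ℝ] C(Set.Icc a b, ℝ))
    (hKop : ∀ (μ : C(Set.Icc a b, ℝ) →L[ℝ] ℝ) (s : Set.Icc a b), Kop μ s = μ (K.curry s))
    (hpos : ∀ μ : C(Set.Icc a b, ℝ) →L[ℝ] ℝ, 0 ≤ μ (Kop μ))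
    (hsym : ∀ μ ν : C(Set.Icc a b, ℝ) →L[ℝ] ℝ, μ (Kop ν) = ν (Kop μ))
    (Z : Ω → C(Set.Icc a b, ℝ))
    (hZmeas : ∀ ν : C(Set.Icc a b, ℝ) →L[ℝ] ℝ, Measurable fun ω => ν (Z ω))
    (hZgauss : ∀ ν : C(Set.Icc a b, ℝ) →L[ℝ] ℝ,
      P.map (fun ω => ν (Z ω)) = gaussianReal 0 (Real.toNNReal (ν (Kop ν))))
    (hZcov : ∀ μ ν : C(Set.Icc a b, ℝ) →L[ℝ] ℝ,
      ∫ ω, μ (Z ω) * ν (Z ω) ∂P = μ (Kop ν))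
    (Θ : Set (Fin p → ℝ)) (hΘc : IsCompact Θ)
    (θ₀ : Fin p → ℝ) (hθ₀ : θ₀ ∈ Θ)
    (μf : (Fin p → ℝ) → (C(Set.Icc a b, ℝ) →L[ℝ] ℝ))
    (hcont : ContinuousOn μf Θ)
    (hident : ∀ θ ∈ Θ, (∀ s : Set.Icc a b, Kop (μf θ) s = Kop (μf θ₀) s) → θ = θ₀)
    (θhat : ℝ → Ω → (Fin p → ℝ))
    (hmem : ∀ ε > (0 : ℝ), ∀ ω, θhat ε ω ∈ Θ)
    (hargmax : ∀ ε > (0 : ℝ), ∀ ω, ∀ θ ∈ Θ,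
      (μf θ) (Kop (μf θ₀) + ε • Z ω) - (1 / 2) * (μf θ) (Kop (μf θ)) ≤
        (μf (θhat ε ω)) (Kop (μf θ₀) + ε • Z ω) -
          (1 / 2) * (μf (θhat ε ω)) (Kop (μf (θhat ε ω)))) :
    ∀ᵐ ω ∂P,
      Tendsto (fun ε => θhat ε ω) (𝓝[>] 0) (𝓝 θ₀) ∧
        Tendsto (fun ε => μf (θhat ε ω)) (𝓝[>] 0) (𝓝 (μf θ₀)) ∧
          Tendsto (fun ε => Kop (μf (θhat ε ω))) (𝓝[>] 0) (𝓝 (Kop (μf θ₀))) := by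
  refine ae_of_all P fun ω => ?_
  set D : (Fin p → ℝ) → ℝ := fun θ => (μf θ - μf θ₀) (Kop (μf θ - μf θ₀)) with hDdef
  have hsub : ContinuousOn (fun θ => μf θ - μf θ₀) Θ := hcont.sub continuousOn_const
  have hD : ContinuousOn D Θ := hsub.clm_apply (Kop.continuous.comp_continuousOn hsub)
  have huniq : ∀ θ ∈ Θ, D θ = 0 → θ = θ₀ := fun θ hθ h => hident θ hθ fun s => by
    have h0 := apply_eq_zero_of_quadratic_eq_zero Kop hpos hsym h
    rw [map_sub, sub_eq_zero] at h0
    rw [h0]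
  obtain ⟨C, hC⟩ := hΘc.exists_bound_of_continuousOn
    (hsub.clm_apply (continuousOn_const (c := Z ω)))
  have hev : ∀ᶠ ε : ℝ in 𝓝[>] 0, 0 < ε := self_mem_nhdsWithin
  have hmem' : ∀ᶠ ε in 𝓝[>] (0 : ℝ), θhat ε ω ∈ Θ := hev.mono fun ε hε => hmem ε hε ω
  have hDlim : Tendsto (fun ε => D (θhat ε ω)) (𝓝[>] 0) (𝓝 0) := by
    have hlim : Tendsto (fun ε : ℝ => 2 * (ε * C)) (𝓝[>] 0) (𝓝 0) := by
      have : Tendsto (fun ε : ℝ => 2 * (ε * C)) (𝓝 0) (𝓝 (2 * (0 * C))) :=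
        Continuous.tendsto (by fun_prop) 0
      simpa using this.mono_left nhdsWithin_le_nhds
    refine squeeze_zero' (Eventually.of_forall fun ε => hpos _) (hev.mono fun ε hε => ?_) hlim
    have hmax := hargmax ε hε ω θ₀ hθ₀
    have hbound := mul_le_mul_of_nonneg_left
      ((le_abs_self _).trans (hC _ (hmem ε hε ω))) hε.le
    have hs := hsym (μf (θhat ε ω)) (μf θ₀)
    simp only [hDdef, map_sub, map_add, map_smul, sub_apply,
      smul_eq_mul] at hmax hbound ⊢
    linarith
  have hθ := tendsto_of_tendsto_zero_of_unique_zero hΘc hD huniq hmem' hDlim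
  have hμ : Tendsto (fun ε => μf (θhat ε ω)) (𝓝[>] 0) (𝓝 (μf θ₀)) :=
    (hcont θ₀ hθ₀).tendsto.comp (tendsto_nhdsWithin_iff.2 ⟨hθ, hmem'⟩)
  exact ⟨hθ, hμ, (Kop.continuous.tendsto _).comp hμ⟩
end
end

section
/- Suppose in addition that K is Lipschitz continuous on T² and the partitions satisfy max_{i=1,…,n} |t_i − t_{i−1}| = O(1/n). Then ε⁻¹(θ̂_{n,ε} − θ₀) → Σ⁻¹⟨∇_θμ_{θ₀}, Z⟩ in probability as n → ∞, ε → 0 and nε → ∞, where ⟨∇_θμ_{θ₀}, Z⟩ := (⟨∂_iμ_{θ₀}, Z⟩)_{1≤i≤p}. -/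
open Filter MeasureTheory ProbabilityTheory Topology Matrix

noncomputable section

/-- Continuous functions converging pointwise (as `k → ∞`) to the indicator of `[a,u]`. -/
def gbump (a b u : ℝ) (k : ℕ) : C(Set.Icc a b, ℝ) :=
  ⟨fun x => max 0 (min 1 (1 - k * (x.1 - u))), by fun_prop⟩

/-- The coefficients `μ(Tᵢ)` of the discretization of `μ`, via the cumulative distribution
function `F μ u = μ([a,u])`. -/
def coef {a b : ℝ} (F : (C(Set.Icc a b, ℝ) →L[ℝ] ℝ) → ℝ → ℝ) (t : ℕ → ℕ → Set.Icc a b)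
    (n : ℕ) (μ : C(Set.Icc a b, ℝ) →L[ℝ] ℝ) (i : ℕ) : ℝ :=
  if i = 1 then F μ (t n 1) else F μ (t n i) - F μ (t n (i - 1))

/-- The discrete contrast `Φₙ(μ; x) = ∑ᵢ μ(Tᵢ) x(tᵢ) − ½ ∑ᵢⱼ μ(Tᵢ)μ(Tⱼ)K(tᵢ,tⱼ)`. -/
def contrastD {a b : ℝ} (F : (C(Set.Icc a b, ℝ) →L[ℝ] ℝ) → ℝ → ℝ) (t : ℕ → ℕ → Set.Icc a b)
    (K : C(Set.Icc a b × Set.Icc a b, ℝ)) (n : ℕ)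
    (μ : C(Set.Icc a b, ℝ) →L[ℝ] ℝ) (x : C(Set.Icc a b, ℝ)) : ℝ :=
  (∑ i ∈ Finset.Icc 1 n, coef F t n μ i * x (t n i)) -
    (1 / 2) * ∑ i ∈ Finset.Icc 1 n, ∑ j ∈ Finset.Icc 1 n,
      coef F t n μ i * coef F t n μ j * K (t n i, t n j)

/-- The continuous linear map `ℝᵖ →L M(T)` determined by the partial derivatives `v i`. -/
def clmOfPartials {a b : ℝ} {p : ℕ} (v : Fin p → (C(Set.Icc a b, ℝ) →L[ℝ] ℝ)) :
    EuclideanSpace ℝ (Fin p) →L[ℝ] (C(Set.Icc a b, ℝ) →L[ℝ] ℝ) :=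
  ∑ i, (EuclideanSpace.proj i).smulRight (v i)

section AbstractRate

variable {E : Type*} [NormedAddCommGroup E] [NormedSpace ℝ E]
  {V : Type*} [NormedAddCommGroup V] [NormedSpace ℝ V]

/-- Degenerate case of the Cauchy–Schwarz inequality for a positive semidefinite form. -/
lemma apply_eq_zero_of_quadratic_eq_zero_s12 {K : (E →L[ℝ] ℝ) →L[ℝ] E}
    (hpos : ∀ μ : E →L[ℝ] ℝ, 0 ≤ μ (K μ)) (hsym : ∀ μ ν : E →L[ℝ] ℝ, μ (K ν) = ν (K μ))
    {e : E →L[ℝ] ℝ} (he : e (K e) = 0) (ν : E →L[ℝ] ℝ) : ν (K e) = 0 := by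
  have h : ∀ s : ℝ, 0 ≤ s ^ 2 * ν (K ν) + 2 * s * ν (K e) := fun s => by
    have h1 := hpos (e + s • ν)
    simp only [map_add, map_smul, _root_.add_apply, _root_.smul_apply, smul_eq_mul] at h1
    rw [he, hsym e ν] at h1
    linarith
  have hν := hpos ν
  have h2 := h (-(ν (K e)) / (ν (K ν) + 1))
  have hp : 0 < ν (K ν) + 1 := by linarith
  have h3 : (-(ν (K e)) / (ν (K ν) + 1)) ^ 2 * ν (K ν)
      + 2 * (-(ν (K e)) / (ν (K ν) + 1)) * ν (K e)
      = -((ν (K e)) ^ 2 * (ν (K ν) + 2)) / (ν (K ν) + 1) ^ 2 := by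
    field_simp
    ring
  rw [h3] at h2
  have h4 : 0 ≤ -((ν (K e)) ^ 2 * (ν (K ν) + 2)) := by
    by_contra hc
    exact absurd h2 (not_le.2 (div_neg_of_neg_of_pos (not_le.1 hc) (by positivity)))
  have h5 : (ν (K e)) ^ 2 = 0 := by nlinarith [sq_nonneg (ν (K e))]
  exact pow_eq_zero_iff (two_ne_zero) |>.1 h5

/-- A minimizing net of a continuous function on a compact set converges to the unique zero. -/
lemma tendsto_of_tendsto_zero_of_unique_zero_s12 {ι X : Type*} [TopologicalSpace X] {l : Filter ι}
    {Θ : Set X} (hΘ : IsCompact Θ) {g : X → ℝ} (hg : ContinuousOn g Θ) {θ₀ : X}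
    (hz : ∀ θ ∈ Θ, g θ = 0 → θ = θ₀) {θh : ι → X} (hmem : ∀ᶠ q in l, θh q ∈ Θ)
    (hlim : Tendsto (fun q => g (θh q)) l (𝓝 0)) : Tendsto θh l (𝓝 θ₀) := by
  refine hΘ.tendsto_nhds_of_unique_mapClusterPt hmem fun y hy hcl => hz y hy ?_
  have h1 : MapClusterPt (g y) l (fun q => g (θh q)) := by
    have hle : Filter.map θh l ≤ 𝓟 Θ := tendsto_principal.2 hmem
    have h2 : ClusterPt y (Filter.map θh l) := hcl
    have h3 : (𝓝[Θ] y ⊓ Filter.map θh l).NeBot := by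
      rw [nhdsWithin, inf_assoc, inf_eq_right.2 hle]
      exact h2
    have h4 : (Filter.map g (𝓝[Θ] y ⊓ Filter.map θh l)).NeBot := h3.map g
    refine h4.mono (le_inf ?_ ?_)
    · exact (map_mono inf_le_left).trans (hg y hy)
    · exact (map_mono inf_le_right).trans (by rw [Filter.map_map]; rfl)
  have h2 : (𝓝 (g y) ⊓ 𝓝 0).NeBot := NeBot.mono h1 (inf_le_inf_left _ hlim)
  exact eq_of_nhds_neBot h2

/-- Consistency of the maximizer of an approximate contrast. -/
lemma tendsto_argmax {ι V : Type*} [TopologicalSpace V] {l : Filter ι} {K : (E →L[ℝ] ℝ) →L[ℝ] E}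
    (hpos : ∀ μ : E →L[ℝ] ℝ, 0 ≤ μ (K μ)) (hsym : ∀ μ ν : E →L[ℝ] ℝ, μ (K ν) = ν (K μ))
    {Θ : Set V} (hΘ : IsCompact Θ) {θ₀ : V} (hθ₀ : θ₀ ∈ Θ) {μf : V → (E →L[ℝ] ℝ)}
    (hcont : ContinuousOn μf Θ)
    (hident : ∀ θ ∈ Θ, (∀ ν : E →L[ℝ] ℝ, ν (K (μf θ)) = ν (K (μf θ₀))) → θ = θ₀)
    {A : ι → (E →L[ℝ] ℝ) →L[ℝ] (E →L[ℝ] ℝ)} {B : ℝ} (hA : ∀ᶠ q in l, ‖A q‖ ≤ B)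
    (hKA : Tendsto (fun q => ‖K ∘L A q - K‖) l (𝓝 0))
    {ε : ι → ℝ} (hε : Tendsto ε l (𝓝 0)) {z : E} {θh : ι → V} (hmem : ∀ᶠ q in l, θh q ∈ Θ)
    (hmax : ∀ᶠ q in l, A q (μf θ₀) (K (μf θ₀) + ε q • z)
        - 1 / 2 * A q (μf θ₀) (K (A q (μf θ₀))) ≤
      A q (μf (θh q)) (K (μf θ₀) + ε q • z)
        - 1 / 2 * A q (μf (θh q)) (K (A q (μf (θh q))))) :
    Tendsto θh l (𝓝 θ₀) := by
  obtain ⟨M, hM⟩ := hΘ.exists_bound_of_continuousOn hcont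
  have hM0 : 0 ≤ M := (norm_nonneg _).trans (hM θ₀ hθ₀)
  refine tendsto_of_tendsto_zero_of_unique_zero_s12 (l := l) hΘ
    (g := fun θ => (μf θ - μf θ₀) (K (μf θ - μf θ₀))) ?_ (fun θ hθ hz => hident θ hθ fun ν => ?_)
    hmem ?_
  · have h1 : ContinuousOn (fun θ => μf θ - μf θ₀) Θ := hcont.sub continuousOn_const
    exact h1.clm_apply (K.continuous.comp_continuousOn h1)
  · have := apply_eq_zero_of_quadratic_eq_zero_s12 hpos hsym hz ν
    rw [map_sub, map_sub] at this
    linarith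
  · have hlim : Tendsto (fun q => 2 * (B * (2 * M) * (‖K ∘L A q - K‖ * M + |ε q| * ‖z‖))
        + (B * (2 * M) + 2 * M) * (‖K ∘L A q - K‖ * (2 * M))) l (𝓝 0) := by
      have hε' := hε.abs
      rw [abs_zero] at hε'
      have := ((((hKA.mul_const M).add (hε'.mul_const ‖z‖)).const_mul (B * (2 * M))).const_mul
        2).add ((hKA.mul_const (2 * M)).const_mul (B * (2 * M) + 2 * M))
      simpa using this
    refine tendsto_of_tendsto_of_tendsto_of_le_of_le' tendsto_const_nhds hlim
      (.of_forall fun q => hpos _) ?_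
    filter_upwards [hmem, hmax, hA] with q hq hmaxq hAq
    set e := μf (θh q) - μf θ₀ with he
    have hB0 : 0 ≤ B := (norm_nonneg (A q)).trans hAq
    have hen : ‖e‖ ≤ 2 * M := (norm_sub_le _ _).trans (by linarith [hM _ hq, hM _ hθ₀])
    set d := A q e with hd
    have hdn : ‖d‖ ≤ B * (2 * M) :=
      ((A q).le_opNorm e).trans (mul_le_mul hAq hen (norm_nonneg _) hB0)
    have hde : A q (μf (θh q)) = A q (μf θ₀) + d := by rw [hd, he, map_sub]; abel
    have hKn : ∀ ν, ‖K (A q ν) - K ν‖ ≤ ‖K ∘L A q - K‖ * ‖ν‖ := fun ν =>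
      (K ∘L A q - K).le_opNorm ν
    have hbasic : d (K d) ≤ 2 * (d (K (μf θ₀) - K (A q (μf θ₀))) + ε q * d z) := by
      rw [hde] at hmaxq
      simp only [map_add, map_smul, _root_.add_apply, smul_eq_mul] at hmaxq
      rw [hsym (A q (μf θ₀)) d] at hmaxq
      rw [map_sub]
      linarith
    have hT1 : d (K (μf θ₀) - K (A q (μf θ₀))) ≤ B * (2 * M) * (‖K ∘L A q - K‖ * M) := by
      refine (le_abs_self _).trans ((d.le_opNorm _).trans (mul_le_mul hdn ?_ (norm_nonneg _)
        (by positivity)))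
      rw [norm_sub_rev]
      exact (hKn _).trans (mul_le_mul_of_nonneg_left (hM _ hθ₀) (norm_nonneg (K ∘L A q - K)))
    have hT2 : ε q * d z ≤ B * (2 * M) * (|ε q| * ‖z‖) := by
      refine (le_abs_self _).trans ?_
      rw [abs_mul]
      have := (d.le_opNorm z).trans (mul_le_mul_of_nonneg_right hdn (norm_nonneg z))
      rw [Real.norm_eq_abs] at this
      calc |ε q| * |d z| ≤ |ε q| * (B * (2 * M) * ‖z‖) :=
            mul_le_mul_of_nonneg_left this (abs_nonneg _)
        _ = _ := by ring
    have hT3 : e (K e) - d (K d) ≤ (B * (2 * M) + 2 * M) * (‖K ∘L A q - K‖ * (2 * M)) := by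
      have h1 : e (K e) - d (K d) = -((d + e) (K d - K e)) := by
        simp only [_root_.add_apply, map_sub]
        rw [hsym e d]
        ring
      rw [h1]
      refine (neg_le_abs _).trans (((d + e).le_opNorm _).trans ?_)
      refine mul_le_mul ((norm_add_le _ _).trans (add_le_add hdn hen)) ?_ (norm_nonneg _)
        (by positivity)
      exact (hKn e).trans (mul_le_mul_of_nonneg_left hen (norm_nonneg (K ∘L A q - K)))
    linarith

/-- First-order condition at an interior maximizer of the contrast. -/
lemma first_order_condition {K : (E →L[ℝ] ℝ) →L[ℝ] E}
    (hsym : ∀ μ ν : E →L[ℝ] ℝ, μ (K ν) = ν (K μ)) {μf : V → (E →L[ℝ] ℝ)}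
    {D : V →L[ℝ] (E →L[ℝ] ℝ)} {A : (E →L[ℝ] ℝ) →L[ℝ] (E →L[ℝ] ℝ)} {x : E} {θ : V}
    (hD : HasFDerivAt μf D θ)
    (hmax : IsLocalMax (fun θ' => A (μf θ') x - 1 / 2 * A (μf θ') (K (A (μf θ')))) θ) (v : V) :
    A (D v) (x - K (A (μf θ))) = 0 := by
  have h1 : HasFDerivAt (fun θ' => A (μf θ')) (A ∘L D) θ := A.hasFDerivAt.comp θ hD
  have h2 : HasFDerivAt (fun θ' => K (A (μf θ'))) (K ∘L (A ∘L D)) θ := K.hasFDerivAt.comp θ h1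
  have h3 := (h1.clm_apply (hasFDerivAt_const x θ)).sub ((h1.clm_apply h2).const_mul (1 / 2))
  have h4 := congrArg (fun f : V →L[ℝ] ℝ => f v) (hmax.hasFDerivAt_eq_zero h3)
  simp at h4
  rw [hsym (A (μf θ)) (A (D v))] at h4
  rw [map_sub]
  linarith

/-- Linearization of the first-order condition: the rescaled error nearly solves the linear
system whose solution is the limit. -/
lemma abs_linearized_error_le {K : (E →L[ℝ] ℝ) →L[ℝ] E}
    (hsym : ∀ μ ν : E →L[ℝ] ℝ, μ (K ν) = ν (K μ))
    {A : (E →L[ℝ] ℝ) →L[ℝ] (E →L[ℝ] ℝ)} {B : ℝ} (hA : ‖A‖ ≤ B) {ε : ℝ} (hε : 0 < ε) {z : E}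
    {D D₀ : V →L[ℝ] (E →L[ℝ] ℝ)} {μ μ₀ : E →L[ℝ] ℝ} {u : V} {τ : ℝ} (hτ0 : 0 ≤ τ)
    (hτ : ‖μ - μ₀ - D₀ u‖ ≤ τ * ‖u‖)
    (hfoc : ∀ v, A (D v) (K μ₀ + ε • z - K (A μ)) = 0) (v : V) :
    |D₀ v (K (D₀ (ε⁻¹ • u))) - D₀ v z| ≤
      (‖D₀‖ * (‖K‖ * ‖D - D₀‖ + ‖K ∘L A - K‖ * ‖D‖) + B * ‖D‖ * ‖K ∘L A - K‖ * ‖D₀‖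
        + B * ‖D‖ * ‖K‖ * B * τ
        + ‖(ContinuousLinearMap.apply ℝ ℝ z) ∘L A - ContinuousLinearMap.apply ℝ ℝ z‖ * ‖D‖
        + ‖D - D₀‖ * ‖z‖ + B * ‖D‖ * (‖K ∘L A - K‖ / ε) * ‖μ₀‖) * (1 + ‖ε⁻¹ • u‖) * ‖v‖ := by
  set δ := ‖K ∘L A - K‖ with hδ
  set ρ := ‖(ContinuousLinearMap.apply ℝ ℝ z) ∘L A - ContinuousLinearMap.apply ℝ ℝ z‖ with hρ
  set h := ε⁻¹ • u with hh
  have hB0 : 0 ≤ B := (norm_nonneg A).trans hA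
  have hδ0 : 0 ≤ δ := norm_nonneg (K ∘L A - K)
  have hρ0 : 0 ≤ ρ := norm_nonneg
    ((ContinuousLinearMap.apply ℝ ℝ z) ∘L A - ContinuousLinearMap.apply ℝ ℝ z)
  have hKn : ∀ ν, ‖K (A ν) - K ν‖ ≤ δ * ‖ν‖ := fun ν => (K ∘L A - K).le_opNorm ν
  have hzn : ∀ ν : E →L[ℝ] ℝ, |A ν z - ν z| ≤ ρ * ‖ν‖ := fun ν =>
    ((ContinuousLinearMap.apply ℝ ℝ z) ∘L A - ContinuousLinearMap.apply ℝ ℝ z).le_opNorm ν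
  have hAn : ∀ ν, ‖A ν‖ ≤ B * ‖ν‖ := fun ν => A.le_of_opNorm_le hA ν
  have hDv : ‖D v‖ ≤ ‖D‖ * ‖v‖ := D.le_opNorm v
  have hADv : ‖A (D v)‖ ≤ B * ‖D‖ * ‖v‖ := by
    rw [mul_assoc]; exact (hAn _).trans (mul_le_mul_of_nonneg_left hDv hB0)
  have hDh : ‖D₀ h‖ ≤ ‖D₀‖ * ‖h‖ := D₀.le_opNorm h
  have hDD : ‖D v - D₀ v‖ ≤ ‖D - D₀‖ * ‖v‖ := (D - D₀).le_opNorm v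
  have hun : ε⁻¹ * ‖u‖ = ‖h‖ := by
    rw [hh, norm_smul, Real.norm_of_nonneg (inv_nonneg.2 hε.le)]
  have hT1 : |(D₀ h) (K (D₀ v - A (D v)))| ≤
      ‖D₀‖ * (‖K‖ * ‖D - D₀‖ + δ * ‖D‖) * ‖h‖ * ‖v‖ := by
    have h1 : K (D₀ v - A (D v)) = -(K (D v - D₀ v) + (K (A (D v)) - K (D v))) := by
      simp only [map_sub]; abel
    have h2 : ‖K (D₀ v - A (D v))‖ ≤ (‖K‖ * ‖D - D₀‖ + δ * ‖D‖) * ‖v‖ := by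
      rw [h1, norm_neg]
      refine (norm_add_le _ _).trans ?_
      have := (K.le_opNorm (D v - D₀ v)).trans (mul_le_mul_of_nonneg_left hDD (norm_nonneg K))
      have := (hKn (D v)).trans (mul_le_mul_of_nonneg_left hDv hδ0)
      linarith
    refine ((D₀ h).le_opNorm _).trans ((mul_le_mul hDh h2 (norm_nonneg _)
      (by positivity)).trans (le_of_eq (by ring)))
  have hT2 : |A (D v) (K (A (D₀ h)) - K (D₀ h))| ≤ B * ‖D‖ * δ * ‖D₀‖ * ‖h‖ * ‖v‖ := by
    refine ((A (D v)).le_opNorm _).trans ((mul_le_mul hADv ((hKn (D₀ h)).trans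
      (mul_le_mul_of_nonneg_left hDh hδ0)) (norm_nonneg _) (by positivity)).trans
      (le_of_eq (by ring)))
  have hT3 : |ε⁻¹ * A (D v) (K (A (μ - μ₀ - D₀ u)))| ≤
      B * ‖D‖ * ‖K‖ * B * τ * ‖h‖ * ‖v‖ := by
    have h1 : ‖K (A (μ - μ₀ - D₀ u))‖ ≤ ‖K‖ * (B * (τ * ‖u‖)) :=
      (K.le_opNorm _).trans (mul_le_mul_of_nonneg_left ((hAn _).trans
        (mul_le_mul_of_nonneg_left hτ hB0)) (norm_nonneg _))
    rw [abs_mul, abs_of_pos (inv_pos.2 hε), ← hun]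
    calc _ ≤ ε⁻¹ * ((B * ‖D‖ * ‖v‖) * (‖K‖ * (B * (τ * ‖u‖)))) :=
          mul_le_mul_of_nonneg_left (((A (D v)).le_opNorm _).trans
            (mul_le_mul hADv h1 (norm_nonneg _) (by positivity))) (inv_nonneg.2 hε.le)
      _ = _ := by ring
  have hT4 : |A (D v) z - D₀ v z| ≤ (ρ * ‖D‖ + ‖D - D₀‖ * ‖z‖) * ‖v‖ := by
    have h1 : A (D v) z - D₀ v z = (A (D v) z - D v z) + (D v - D₀ v) z := by
      simp only [_root_.sub_apply]; ring
    rw [h1]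
    refine (abs_add_le _ _).trans ?_
    have h2 := (hzn (D v)).trans (mul_le_mul_of_nonneg_left hDv hρ0)
    have h3 : |(D v - D₀ v) z| ≤ _ := ((D v - D₀ v).le_opNorm z).trans
      (mul_le_mul_of_nonneg_right hDD (norm_nonneg z))
    linarith
  have hT5 : |ε⁻¹ * A (D v) (K (A μ₀) - K μ₀)| ≤ B * ‖D‖ * (δ / ε) * ‖μ₀‖ * ‖v‖ := by
    rw [abs_mul, abs_of_pos (inv_pos.2 hε)]
    calc _ ≤ ε⁻¹ * ((B * ‖D‖ * ‖v‖) * (δ * ‖μ₀‖)) :=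
          mul_le_mul_of_nonneg_left (((A (D v)).le_opNorm _).trans
            (mul_le_mul hADv (hKn μ₀) (norm_nonneg _) (by positivity))) (inv_nonneg.2 hε.le)
      _ = _ := by ring
  have hid : D₀ v (K (D₀ h)) - D₀ v z = (D₀ h) (K (D₀ v - A (D v)))
      - A (D v) (K (A (D₀ h)) - K (D₀ h)) - ε⁻¹ * A (D v) (K (A (μ - μ₀ - D₀ u)))
      + (A (D v) z - D₀ v z) - ε⁻¹ * A (D v) (K (A μ₀) - K μ₀) := by
    have h1 := hfoc v
    have h2 : D₀ h = ε⁻¹ • D₀ u := by rw [hh, map_smul]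
    have h3 : (D₀ h) (K (D₀ v - A (D v))) = D₀ v (K (D₀ h)) - A (D v) (K (D₀ h)) := by
      rw [map_sub, map_sub, hsym, hsym (D₀ h)]
    rw [h3, h2]
    simp only [map_sub, map_add, map_smul, smul_eq_mul] at h1 ⊢
    have h4 : A (D v) z = ε⁻¹ * (A (D v) (K (A μ)) - A (D v) (K μ₀)) := by
      field_simp
      linarith
    rw [h4]
    ring
  have htri : |D₀ v (K (D₀ h)) - D₀ v z| ≤ |(D₀ h) (K (D₀ v - A (D v)))|
      + |A (D v) (K (A (D₀ h)) - K (D₀ h))| + |ε⁻¹ * A (D v) (K (A (μ - μ₀ - D₀ u)))|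
      + |A (D v) z - D₀ v z| + |ε⁻¹ * A (D v) (K (A μ₀) - K μ₀)| := by
    rw [hid]
    refine (abs_sub _ _).trans (add_le_add_left ((abs_add_le _ _).trans (add_le_add_left
      ((abs_sub _ _).trans (add_le_add_left (abs_sub _ _) _)) _)) _)
  have hgrow : ∀ x : ℝ, 0 ≤ x → x * ‖h‖ * ‖v‖ ≤ x * (1 + ‖h‖) * ‖v‖ := fun x hx => by
    gcongr; linarith
  have hconst : ∀ x : ℝ, 0 ≤ x → x * ‖v‖ ≤ x * (1 + ‖h‖) * ‖v‖ := fun x hx => by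
    gcongr; exact le_mul_of_one_le_right hx (by linarith [norm_nonneg h])
  have h1 := hT1.trans (hgrow _ (by positivity))
  have h2 := hT2.trans (hgrow _ (by positivity))
  have h3 := hT3.trans (hgrow _ (by positivity))
  have h4 := hT4.trans (hconst _ (by positivity))
  have h5 := hT5.trans (hconst _ (by positivity))
  linarith

/-- Limit of the rescaled error of the maximizer of an approximate contrast. -/
lemma tendsto_rescaled_argmax {ι : Type*} {l : Filter ι} {K : (E →L[ℝ] ℝ) →L[ℝ] E}
    (hpos : ∀ μ : E →L[ℝ] ℝ, 0 ≤ μ (K μ)) (hsym : ∀ μ ν : E →L[ℝ] ℝ, μ (K ν) = ν (K μ))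
    {Θ : Set V} (hΘ : IsCompact Θ) {θ₀ : V} (hθ₀ : θ₀ ∈ interior Θ) {μf : V → (E →L[ℝ] ℝ)}
    {D : V → V →L[ℝ] (E →L[ℝ] ℝ)} (hD : ∀ θ ∈ Θ, HasFDerivWithinAt μf (D θ) Θ θ)
    (hDcont : ContinuousWithinAt D Θ θ₀)
    (hident : ∀ θ ∈ Θ, (∀ ν : E →L[ℝ] ℝ, ν (K (μf θ)) = ν (K (μf θ₀))) → θ = θ₀)
    {A : ι → (E →L[ℝ] ℝ) →L[ℝ] (E →L[ℝ] ℝ)} {B : ℝ} (hA : ∀ᶠ q in l, ‖A q‖ ≤ B)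
    {ε : ι → ℝ} (hε : Tendsto ε l (𝓝[>] 0))
    (hKA : Tendsto (fun q => ‖K ∘L A q - K‖ / ε q) l (𝓝 0)) {z : E}
    (hAz : Tendsto (fun q => ‖(ContinuousLinearMap.apply ℝ ℝ z) ∘L A q
      - ContinuousLinearMap.apply ℝ ℝ z‖) l (𝓝 0))
    {θh : ι → V} (hmem : ∀ᶠ q in l, θh q ∈ Θ)
    (hmax : ∀ᶠ q in l, ∀ θ ∈ Θ, A q (μf θ) (K (μf θ₀) + ε q • z)
        - 1 / 2 * A q (μf θ) (K (A q (μf θ))) ≤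
      A q (μf (θh q)) (K (μf θ₀) + ε q • z)
        - 1 / 2 * A q (μf (θh q)) (K (A q (μf (θh q)))))
    {c : ℝ} (hc : ∀ (u : V) (m : ℝ), 0 ≤ m → (∀ v, |D θ₀ v (K (D θ₀ u))| ≤ m * ‖v‖) → ‖u‖ ≤ c * m)
    {h : V} (hh : ∀ v, D θ₀ v (K (D θ₀ h)) = D θ₀ v z) :
    Tendsto (fun q => (ε q)⁻¹ • (θh q - θ₀)) l (𝓝 h) := by
  have hθ₀Θ := interior_subset hθ₀
  have hεpos : ∀ᶠ q in l, 0 < ε q := hε.eventually self_mem_nhdsWithin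
  have hε0 : Tendsto ε l (𝓝 0) := hε.mono_right nhdsWithin_le_nhds
  have hKA0 : Tendsto (fun q => ‖K ∘L A q - K‖) l (𝓝 0) := by
    have h1 := hKA.mul hε0
    rw [zero_mul] at h1
    refine h1.congr' ?_
    filter_upwards [hεpos] with q hq using div_mul_cancel₀ _ hq.ne'
  have hlim : Tendsto θh l (𝓝 θ₀) :=
    tendsto_argmax hpos hsym hΘ hθ₀Θ (fun θ hθ => (hD θ hθ).continuousWithinAt) hident hA hKA0
      hε0 hmem (hmax.mono fun q hq => hq _ hθ₀Θ)
  have hlimΘ : Tendsto θh l (𝓝[Θ] θ₀) := tendsto_nhdsWithin_iff.2 ⟨hlim, hmem⟩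
  have hDlim : Tendsto (fun q => D (θh q)) l (𝓝 (D θ₀)) := hDcont.tendsto.comp hlimΘ
  have hκ : Tendsto (fun q => ‖D (θh q) - D θ₀‖) l (𝓝 0) :=
    (tendsto_iff_norm_sub_tendsto_zero (E := V →L[ℝ] (E →L[ℝ] ℝ))).1 hDlim
  obtain ⟨τ, hτ0, hτle, hτlim⟩ : ∃ τ : ι → ℝ, (∀ q, 0 ≤ τ q) ∧
      (∀ q, ‖μf (θh q) - μf θ₀ - D θ₀ (θh q - θ₀)‖ ≤ τ q * ‖θh q - θ₀‖) ∧
      Tendsto τ l (𝓝 0) := by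
    refine ⟨fun q => ‖θh q - θ₀‖⁻¹ * ‖μf (θh q) - μf θ₀ - D θ₀ (θh q - θ₀)‖,
      fun q => by positivity, fun q => ?_,
      (hasFDerivWithinAt_iff_tendsto.1 (hD θ₀ hθ₀Θ)).comp hlimΘ⟩
    by_cases hq : θh q = θ₀
    · simp [hq]
    · have : ‖θh q - θ₀‖ ≠ 0 := norm_ne_zero_iff.2 (sub_ne_zero.2 hq)
      field_simp
      exact le_rfl
  obtain ⟨η, hη⟩ : ∃ η : ι → ℝ, η = fun q =>
    ‖D θ₀‖ * (‖K‖ * ‖D (θh q) - D θ₀‖ + ‖K ∘L A q - K‖ * ‖D (θh q)‖)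
    + B * ‖D (θh q)‖ * ‖K ∘L A q - K‖ * ‖D θ₀‖ + B * ‖D (θh q)‖ * ‖K‖ * B * τ q
    + ‖(ContinuousLinearMap.apply ℝ ℝ z) ∘L A q - ContinuousLinearMap.apply ℝ ℝ z‖ * ‖D (θh q)‖
    + ‖D (θh q) - D θ₀‖ * ‖z‖ + B * ‖D (θh q)‖ * (‖K ∘L A q - K‖ / ε q) * ‖μf θ₀‖ := ⟨_, rfl⟩
  have hd : Tendsto (fun q => ‖D (θh q)‖) l (𝓝 ‖D θ₀‖) :=
    Filter.Tendsto.norm (E := V →L[ℝ] (E →L[ℝ] ℝ)) hDlim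
  have hηlim : Tendsto η l (𝓝 0) := by
    have h1 := (((((((hκ.const_mul ‖K‖).add (hKA0.mul hd)).const_mul ‖D θ₀‖).add
      (((hd.const_mul B).mul hKA0).mul_const ‖D θ₀‖)).add
      ((((hd.const_mul B).mul_const ‖K‖).mul_const B).mul hτlim)).add (hAz.mul hd)).add
      (hκ.mul_const ‖z‖)).add (((hd.const_mul B).mul hKA).mul_const ‖μf θ₀‖)
    rw [hη]
    simpa using h1
  have hkey : ∀ᶠ q in l, ‖(ε q)⁻¹ • (θh q - θ₀) - h‖ ≤
      c * (|η q| * (1 + ‖(ε q)⁻¹ • (θh q - θ₀)‖)) := by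
    filter_upwards [hmax, hA, hεpos, hlim.eventually (isOpen_interior.mem_nhds hθ₀), hmem]
      with q hmaxq hAq hεq hint hq
    refine hc _ _ (by positivity) fun v => ?_
    have hnhds : Θ ∈ 𝓝 (θh q) := mem_interior_iff_mem_nhds.1 hint
    have hfoc := first_order_condition (x := K (μf θ₀) + ε q • z) (A := A q) hsym
      ((hD _ hq).hasFDerivAt hnhds) (by filter_upwards [hnhds] with θ hθ using hmaxq θ hθ)
    have h1 := abs_linearized_error_le hsym hAq hεq (hτ0 q) (hτle q) hfoc v
    rw [map_sub, map_sub, map_sub, hh]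
    refine h1.trans ?_
    gcongr
    rw [hη]
    exact le_abs_self _
  have hcη : Tendsto (fun q => abs (c * abs (η q))) l (𝓝 0) := by
    simpa using (hηlim.abs.const_mul c).abs
  rw [tendsto_iff_norm_sub_tendsto_zero]
  have hbound : Tendsto (fun q => 2 * (1 + ‖h‖) * abs (c * abs (η q))) l (𝓝 0) := by
    simpa using hcη.const_mul (2 * (1 + ‖h‖))
  refine squeeze_zero' (.of_forall fun q => norm_nonneg _) ?_ hbound
  have hsmall : ∀ᶠ q in l, abs (c * abs (η q)) < 1 / 2 :=
    hcη.eventually (gt_mem_nhds (by norm_num))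
  filter_upwards [hkey, hsmall] with q hq hs
  set w := (ε q)⁻¹ • (θh q - θ₀)
  have h1 : ‖w‖ ≤ ‖w - h‖ + ‖h‖ := by simpa using norm_add_le (w - h) h
  have h2 : c * (|η q| * (1 + ‖w‖)) ≤ abs (c * abs (η q)) * (1 + (‖w - h‖ + ‖h‖)) := by
    rw [← mul_assoc]
    exact mul_le_mul (le_abs_self _) (by linarith) (by positivity) (abs_nonneg _)
  nlinarith [norm_nonneg (w - h), norm_nonneg h, abs_nonneg (c * abs (η q))]

end AbstractRate

section Partials

variable {E : Type*} [NormedAddCommGroup E] [NormedSpace ℝ E] {p : ℕ}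

/-- The continuous linear map `ℝᵖ →L[ℝ] G` with values `w i` on the standard basis. -/
def ofPartials {G : Type*} [NormedAddCommGroup G] [NormedSpace ℝ G] (w : Fin p → G) :
    EuclideanSpace ℝ (Fin p) →L[ℝ] G :=
  ∑ i, (EuclideanSpace.proj i).smulRight (w i)

lemma ofPartials_apply {G : Type*} [NormedAddCommGroup G] [NormedSpace ℝ G] (w : Fin p → G)
    (v : EuclideanSpace ℝ (Fin p)) : ofPartials w v = ∑ i, v i • w i := by
  simp [ofPartials]

lemma continuous_ofPartials {G : Type*} [NormedAddCommGroup G] [NormedSpace ℝ G] :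
    Continuous (ofPartials : (Fin p → G) → EuclideanSpace ℝ (Fin p) →L[ℝ] G) := by
  unfold ofPartials
  refine continuous_finsetSum _ fun i _ => ?_
  exact ((ContinuousLinearMap.smulRightL ℝ (EuclideanSpace ℝ (Fin p)) G)
    (EuclideanSpace.proj i)).continuous.comp (continuous_apply i)

lemma ofPartials_apply_apply_eq {Sig : Matrix (Fin p) (Fin p) ℝ} {K : (E →L[ℝ] ℝ) →L[ℝ] E}
    {w : Fin p → (E →L[ℝ] ℝ)} (hSig : ∀ i j, Sig i j = w i (K (w j)))
    (u v : EuclideanSpace ℝ (Fin p)) :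
    ofPartials w v (K (ofPartials w u)) = ∑ i, v i * (Sig *ᵥ u) i := by
  simp only [ofPartials_apply, map_sum, map_smul, _root_.sum_apply, _root_.smul_apply,
    smul_eq_mul, Matrix.mulVec, dotProduct, hSig, Finset.mul_sum]
  rw [Finset.sum_comm]
  exact Finset.sum_congr rfl fun i _ => Finset.sum_congr rfl fun j _ => by ring

lemma exists_norm_le_of_isUnit_det {Sig : Matrix (Fin p) (Fin p) ℝ} (hdet : IsUnit Sig.det)
    {K : (E →L[ℝ] ℝ) →L[ℝ] E} {w : Fin p → (E →L[ℝ] ℝ)}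
    (hSig : ∀ i j, Sig i j = w i (K (w j))) :
    ∃ c : ℝ, ∀ (u : EuclideanSpace ℝ (Fin p)) (m : ℝ), 0 ≤ m →
      (∀ v, |ofPartials w v (K (ofPartials w u))| ≤ m * ‖v‖) → ‖u‖ ≤ c * m := by
  let S : EuclideanSpace ℝ (Fin p) →L[ℝ] EuclideanSpace ℝ (Fin p) →L[ℝ] ℝ :=
    (ofPartials w).flip ∘L K ∘L ofPartials w
  have hS : ∀ u v, S u v = ∑ i, v i * (Sig *ᵥ u) i := fun u v =>
    ofPartials_apply_apply_eq hSig u v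
  have hker : LinearMap.ker S.toLinearMap = ⊥ := by
    refine LinearMap.ker_eq_bot'.2 fun u hu => ?_
    have h1 : Sig *ᵥ u.ofLp = 0 := by
      ext i
      have h2 := hS u (EuclideanSpace.single i 1)
      have h3 : S u = 0 := hu
      rw [h3] at h2
      simpa using h2.symm
    have h4 := Matrix.eq_zero_of_mulVec_eq_zero hdet.ne_zero h1
    ext i
    exact congrFun h4 i
  obtain ⟨c, -, hc⟩ := LinearMap.exists_antilipschitzWith _ hker
  refine ⟨c, fun u m hm h => (ZeroHomClass.bound_of_antilipschitz S hc u).trans ?_⟩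
  exact mul_le_mul_of_nonneg_left (S u |>.opNorm_le_bound hm h) c.2

lemma ofPartials_apply_eq_of_isUnit_det {Sig : Matrix (Fin p) (Fin p) ℝ}
    (hdet : IsUnit Sig.det) {K : (E →L[ℝ] ℝ) →L[ℝ] E} {w : Fin p → (E →L[ℝ] ℝ)}
    (hSig : ∀ i j, Sig i j = w i (K (w j))) (z : E) (v : EuclideanSpace ℝ (Fin p)) :
    ofPartials w v (K (ofPartials w (WithLp.toLp 2 (Sig⁻¹ *ᵥ fun j => w j z))))
      = ofPartials w v z := by
  rw [ofPartials_apply_apply_eq hSig, Matrix.mulVec_mulVec, Matrix.mul_nonsing_inv _ hdet,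
    Matrix.one_mulVec, ofPartials_apply]
  simp

/-- Rate of convergence of the argmax of a perturbed quadratic contrast whose model has partial
derivatives `Dμ θ i`, with an invertible Gram matrix at the true parameter. -/
lemma tendsto_rescaled_argmax_of_partials {ι : Type*} {l : Filter ι} {K : (E →L[ℝ] ℝ) →L[ℝ] E}
    (hpos : ∀ μ : E →L[ℝ] ℝ, 0 ≤ μ (K μ)) (hsym : ∀ μ ν : E →L[ℝ] ℝ, μ (K ν) = ν (K μ))
    {Θ : Set (EuclideanSpace ℝ (Fin p))} (hΘ : IsCompact Θ) {θ₀ : EuclideanSpace ℝ (Fin p)}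
    (hθ₀ : θ₀ ∈ interior Θ) {μf : EuclideanSpace ℝ (Fin p) → (E →L[ℝ] ℝ)}
    {Dμ : EuclideanSpace ℝ (Fin p) → Fin p → (E →L[ℝ] ℝ)}
    (hD : ∀ θ ∈ Θ, HasFDerivWithinAt μf (ofPartials (Dμ θ)) Θ θ)
    (hDcont : ∀ i, ContinuousWithinAt (fun θ => Dμ θ i) Θ θ₀)
    (hident : ∀ θ ∈ Θ, (∀ ν : E →L[ℝ] ℝ, ν (K (μf θ)) = ν (K (μf θ₀))) → θ = θ₀)
    {A : ι → (E →L[ℝ] ℝ) →L[ℝ] (E →L[ℝ] ℝ)} {B : ℝ} (hB : 0 ≤ B)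
    (hA : ∀ᶠ q in l, ∀ μ : E →L[ℝ] ℝ, ‖A q μ‖ ≤ B * ‖μ‖)
    {ε : ι → ℝ} (hε : Tendsto ε l (𝓝[>] 0)) {δ : ι → ℝ} (hδ : ∀ᶠ q in l, 0 ≤ δ q)
    (hδε : Tendsto (fun q => δ q / ε q) l (𝓝 0))
    (hKA : ∀ᶠ q in l, ∀ μ : E →L[ℝ] ℝ, ‖K (A q μ) - K μ‖ ≤ δ q * ‖μ‖) {z : E}
    (hAz : ∀ r > 0, ∀ᶠ q in l, ∀ μ : E →L[ℝ] ℝ, |A q μ z - μ z| ≤ r * ‖μ‖)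
    {θh : ι → EuclideanSpace ℝ (Fin p)} (hmem : ∀ᶠ q in l, θh q ∈ Θ)
    (hmax : ∀ᶠ q in l, ∀ θ ∈ Θ, A q (μf θ) (K (μf θ₀) + ε q • z)
        - 1 / 2 * A q (μf θ) (K (A q (μf θ))) ≤
      A q (μf (θh q)) (K (μf θ₀) + ε q • z)
        - 1 / 2 * A q (μf (θh q)) (K (A q (μf (θh q)))))
    {Sig : Matrix (Fin p) (Fin p) ℝ} (hSig : ∀ i j, Sig i j = Dμ θ₀ i (K (Dμ θ₀ j)))
    (hdet : IsUnit Sig.det) :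
    Tendsto (fun q => (ε q)⁻¹ • (θh q - θ₀)) l
      (𝓝 (WithLp.toLp 2 (Sig⁻¹ *ᵥ fun j => Dμ θ₀ j z))) := by
  obtain ⟨c, hc⟩ := exists_norm_le_of_isUnit_det hdet hSig
  refine tendsto_rescaled_argmax (D := fun θ => ofPartials (Dμ θ)) hpos hsym hΘ hθ₀ hD ?_ hident
    (hA.mono fun q hq => (A q).opNorm_le_bound hB hq) hε ?_ ?_ hmem hmax hc
    (ofPartials_apply_eq_of_isUnit_det hdet hSig z)
  · exact continuous_ofPartials.continuousAt.comp_continuousWithinAt (continuousWithinAt_pi.2 hDcont)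
  · refine squeeze_zero' ?_ ?_ hδε
    · filter_upwards [hε.eventually self_mem_nhdsWithin] with q hq
      exact div_nonneg (ContinuousLinearMap.opNorm_nonneg _) (le_of_lt hq)
    · filter_upwards [hε.eventually self_mem_nhdsWithin, hδ, hKA] with q hq hq2 hq3
      exact div_le_div_of_nonneg_right (ContinuousLinearMap.opNorm_le_bound _ hq2 hq3) (le_of_lt hq)
  · rw [Metric.tendsto_nhds]
    intro r hr
    filter_upwards [hAz (r / 2) (half_pos hr)] with q hq
    rw [dist_zero_right, Real.norm_of_nonneg (ContinuousLinearMap.opNorm_nonneg _)]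
    exact (ContinuousLinearMap.opNorm_le_bound _ (half_pos hr).le hq).trans_lt (half_lt_self hr)

end Partials

section Discretization

variable {a b : ℝ} {F : (C(Set.Icc a b, ℝ) →L[ℝ] ℝ) → ℝ → ℝ}

lemma gbump_apply (a b u : ℝ) (k : ℕ) (s : Set.Icc a b) :
    gbump a b u k s = max 0 (min 1 (1 - k * (s.1 - u))) := rfl

lemma norm_gbump_le_one (a b u : ℝ) (k : ℕ) : ‖gbump a b u k‖ ≤ 1 := by
  refine (ContinuousMap.norm_le _ zero_le_one).2 fun s => ?_
  rw [gbump_apply, Real.norm_of_nonneg (le_max_left _ _)]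
  exact max_le zero_le_one (min_le_left _ _)

/-- The cumulative distribution function at `u`, as a continuous linear functional of the
measure. -/
def cdfCLM (hF : ∀ (μ : C(Set.Icc a b, ℝ) →L[ℝ] ℝ) (u : ℝ),
      Tendsto (fun k : ℕ => μ (gbump a b u k)) atTop (𝓝 (F μ u))) (u : ℝ) :
    (C(Set.Icc a b, ℝ) →L[ℝ] ℝ) →L[ℝ] ℝ :=
  LinearMap.mkContinuous
    { toFun := fun μ => F μ u
      map_add' := fun μ ν => tendsto_nhds_unique (hF (μ + ν) u) ((hF μ u).add (hF ν u))
      map_smul' := fun c μ => tendsto_nhds_unique (hF (c • μ) u) ((hF μ u).const_mul c) } 1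
    fun μ => le_of_tendsto (hF μ u).norm (.of_forall fun k => by
      rw [one_mul]
      exact (μ.le_opNorm _).trans
        (mul_le_of_le_one_right (norm_nonneg _) (norm_gbump_le_one a b u k)))

/-- The map `μ ↦ ∑ᵢ μ(Tᵢ) δ_{tᵢ}`. -/
def discretization (hF : ∀ (μ : C(Set.Icc a b, ℝ) →L[ℝ] ℝ) (u : ℝ),
      Tendsto (fun k : ℕ => μ (gbump a b u k)) atTop (𝓝 (F μ u)))
    (t : ℕ → ℕ → Set.Icc a b) (n : ℕ) :
    (C(Set.Icc a b, ℝ) →L[ℝ] ℝ) →L[ℝ] (C(Set.Icc a b, ℝ) →L[ℝ] ℝ) :=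
  ∑ i ∈ Finset.Icc 1 n, ContinuousLinearMap.smulRight
    (if i = 1 then cdfCLM hF (t n 1) else cdfCLM hF (t n i) - cdfCLM hF (t n (i - 1)))
    (ContinuousMap.evalCLM ℝ (t n i))

lemma discretization_apply (hF : ∀ (μ : C(Set.Icc a b, ℝ) →L[ℝ] ℝ) (u : ℝ),
      Tendsto (fun k : ℕ => μ (gbump a b u k)) atTop (𝓝 (F μ u)))
    (t : ℕ → ℕ → Set.Icc a b) (n : ℕ) (μ : C(Set.Icc a b, ℝ) →L[ℝ] ℝ) (x : C(Set.Icc a b, ℝ)) :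
    discretization hF t n μ x = ∑ i ∈ Finset.Icc 1 n, coef F t n μ i * x (t n i) := by
  simp only [discretization, _root_.sum_apply]
  refine Finset.sum_congr rfl fun i _ => ?_
  by_cases hi : i = 1
  · simp only [hi, if_true, coef]; rfl
  · simp only [hi, if_false, coef]; rfl

lemma contrastD_eq (hF : ∀ (μ : C(Set.Icc a b, ℝ) →L[ℝ] ℝ) (u : ℝ),
      Tendsto (fun k : ℕ => μ (gbump a b u k)) atTop (𝓝 (F μ u)))
    (t : ℕ → ℕ → Set.Icc a b) (n : ℕ) {K : C(Set.Icc a b × Set.Icc a b, ℝ)}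
    {Kop : (C(Set.Icc a b, ℝ) →L[ℝ] ℝ) →L[ℝ] C(Set.Icc a b, ℝ)}
    (hKop : ∀ (μ : C(Set.Icc a b, ℝ) →L[ℝ] ℝ) (s : Set.Icc a b), Kop μ s = μ (K.curry s))
    (μ : C(Set.Icc a b, ℝ) →L[ℝ] ℝ) (x : C(Set.Icc a b, ℝ)) :
    contrastD F t K n μ x = discretization hF t n μ x
      - 1 / 2 * discretization hF t n μ (Kop (discretization hF t n μ)) := by
  rw [contrastD, discretization_apply, discretization_apply]
  congr 2
  refine Finset.sum_congr rfl fun i _ => ?_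
  rw [hKop, discretization_apply, Finset.mul_sum]
  refine Finset.sum_congr rfl fun j _ => ?_
  rw [ContinuousMap.curry_apply, mul_assoc]

/-- Weights of the smoothed step-function interpolation along a partition. -/
def bumpWeight (t : ℕ → Set.Icc a b) (k i : ℕ) : C(Set.Icc a b, ℝ) :=
  if i = 1 then gbump a b (t 1) k else gbump a b (t i) k - gbump a b (t (i - 1)) k

lemma sum_bumpWeight (t : ℕ → Set.Icc a b) (k : ℕ) {n : ℕ} (hn : 1 ≤ n) :
    ∑ i ∈ Finset.Icc 1 n, bumpWeight t k i = gbump a b (t n) k := by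
  induction n, hn using Nat.le_induction with
  | base => simp [bumpWeight]
  | succ m hm ih =>
    rw [Finset.sum_Icc_succ_top (by omega), ih, bumpWeight, if_neg (by omega), Nat.add_sub_cancel]
    abel

lemma gbump_le_gbump {u v : ℝ} (huv : u ≤ v) (k : ℕ) (s : Set.Icc a b) :
    gbump a b u k s ≤ gbump a b v k s := by
  rw [gbump_apply, gbump_apply]
  gcongr

lemma gbump_eq_one {u : ℝ} (k : ℕ) {s : Set.Icc a b} (h : (s : ℝ) ≤ u) :
    gbump a b u k s = 1 := by
  have h1 : (k : ℝ) * (s.1 - u) ≤ 0 :=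
    mul_nonpos_of_nonneg_of_nonpos (Nat.cast_nonneg k) (by linarith)
  rw [gbump_apply, min_eq_left (by linarith), max_eq_right zero_le_one]

lemma gbump_eq_zero {u δ : ℝ} {k : ℕ} (hk : 1 ≤ k * δ) {s : Set.Icc a b}
    (h : δ ≤ (s : ℝ) - u) : gbump a b u k s = 0 := by
  have h1 : (k : ℝ) * δ ≤ k * (s.1 - u) := mul_le_mul_of_nonneg_left h (Nat.cast_nonneg k)
  rw [gbump_apply]
  exact max_eq_left ((min_le_right _ _).trans (by linarith))

lemma bumpWeight_nonneg {t : ℕ → Set.Icc a b} {n : ℕ}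
    (htmono : ∀ i < n, (t i : ℝ) < (t (i + 1) : ℝ)) (k : ℕ) {i : ℕ} (hi : i ∈ Finset.Icc 1 n)
    (s : Set.Icc a b) : 0 ≤ bumpWeight t k i s := by
  obtain ⟨h1, h2⟩ := Finset.mem_Icc.1 hi
  rw [bumpWeight]
  split_ifs with h
  · exact le_max_left _ _
  · have := htmono (i - 1) (by omega)
    rw [Nat.sub_add_cancel h1] at this
    exact sub_nonneg.2 (gbump_le_gbump this.le k s)

lemma abs_sub_le_of_bumpWeight_ne_zero {t : ℕ → Set.Icc a b} {n : ℕ} (ht0 : (t 0 : ℝ) = a)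
    {δ : ℝ} (hmesh : ∀ i < n, (t (i + 1) : ℝ) - (t i : ℝ) ≤ δ) {k : ℕ} (hk : 1 ≤ k * δ)
    {i : ℕ} (hi : i ∈ Finset.Icc 1 n) {s : Set.Icc a b} (hs : bumpWeight t k i s ≠ 0)
    (hle : (t (i - 1) : ℝ) ≤ t i) : |(t i : ℝ) - s| ≤ δ := by
  obtain ⟨h1, h2⟩ := Finset.mem_Icc.1 hi
  have hm := hmesh (i - 1) (by omega)
  rw [Nat.sub_add_cancel h1] at hm
  contrapose! hs
  rw [bumpWeight]
  rcases lt_abs.1 hs with h | h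
  · have hlt : (s : ℝ) < t (i - 1) := by linarith
    have h3 : i ≠ 1 := by
      rintro rfl
      rw [Nat.sub_self, ht0] at hlt
      exact absurd s.2.1 (not_le.2 hlt)
    rw [if_neg h3, ContinuousMap.sub_apply, gbump_eq_one k (hlt.le.trans hle),
      gbump_eq_one k hlt.le, sub_self]
  · have hzi : gbump a b (t i) k s = 0 := gbump_eq_zero hk (by linarith)
    split_ifs with h3
    · rw [h3] at hzi
      exact hzi
    · rw [ContinuousMap.sub_apply, hzi, gbump_eq_zero hk (by linarith), sub_self]

/-- Quadrature error: discretizing a measure changes its value at `x` by at most the total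
variation times the oscillation of `x` at the scale of the mesh. -/
lemma abs_discretization_sub_le (hF : ∀ (μ : C(Set.Icc a b, ℝ) →L[ℝ] ℝ) (u : ℝ),
      Tendsto (fun k : ℕ => μ (gbump a b u k)) atTop (𝓝 (F μ u)))
    {t : ℕ → ℕ → Set.Icc a b} {n : ℕ} (hn : 1 ≤ n) (ht0 : (t n 0 : ℝ) = a)
    (htlast : (t n n : ℝ) = b) (htmono : ∀ i < n, (t n i : ℝ) < (t n (i + 1) : ℝ))
    {δ : ℝ} (hδ : 0 < δ) (hmesh : ∀ i < n, (t n (i + 1) : ℝ) - (t n i : ℝ) ≤ δ)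
    {x : C(Set.Icc a b, ℝ)} {r : ℝ} (hr : 0 ≤ r)
    (hx : ∀ s u : Set.Icc a b, |(s : ℝ) - u| ≤ δ → |x s - x u| ≤ r)
    (μ : C(Set.Icc a b, ℝ) →L[ℝ] ℝ) : |discretization hF t n μ x - μ x| ≤ ‖μ‖ * r := by
  have hlim : Tendsto (fun k : ℕ => μ (∑ i ∈ Finset.Icc 1 n, x (t n i) • bumpWeight (t n) k i))
      atTop (𝓝 (discretization hF t n μ x)) := by
    rw [discretization_apply]
    simp only [map_sum, map_smul, smul_eq_mul]
    refine tendsto_finsetSum _ fun i _ => ?_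
    rw [mul_comm]
    refine Tendsto.const_mul _ ?_
    by_cases hi : i = 1
    · simp only [bumpWeight, coef, hi, if_true]
      exact hF μ _
    · simp only [bumpWeight, coef, hi, if_false, map_sub]
      exact (hF μ _).sub (hF μ _)
  refine le_of_tendsto (hlim.sub_const (μ x)).abs ?_
  have hk : ∀ᶠ k : ℕ in atTop, 1 ≤ (k : ℝ) * δ :=
    (tendsto_natCast_atTop_atTop.atTop_mul_const hδ).eventually_ge_atTop 1
  filter_upwards [hk] with k hk
  rw [← map_sub]
  refine (μ.le_opNorm _).trans (mul_le_mul_of_nonneg_left ?_ (norm_nonneg _))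
  refine (ContinuousMap.norm_le _ hr).2 fun s => ?_
  have hsum : ∑ i ∈ Finset.Icc 1 n, bumpWeight (t n) k i s = 1 := by
    rw [← ContinuousMap.sum_apply, sum_bumpWeight _ _ hn]
    exact gbump_eq_one k (by rw [htlast]; exact s.2.2)
  have hdiff : (∑ i ∈ Finset.Icc 1 n, x (t n i) • bumpWeight (t n) k i - x) s
      = ∑ i ∈ Finset.Icc 1 n, (x (t n i) - x s) * bumpWeight (t n) k i s := by
    simp only [sub_mul, Finset.sum_sub_distrib, ← Finset.mul_sum, hsum, mul_one,
      ContinuousMap.sub_apply, ContinuousMap.sum_apply, ContinuousMap.smul_apply, smul_eq_mul]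
  rw [hdiff]
  calc ‖∑ i ∈ Finset.Icc 1 n, (x (t n i) - x s) * bumpWeight (t n) k i s‖
      ≤ ∑ i ∈ Finset.Icc 1 n, ‖(x (t n i) - x s) * bumpWeight (t n) k i s‖ := norm_sum_le _ _
    _ ≤ ∑ i ∈ Finset.Icc 1 n, r * bumpWeight (t n) k i s := by
        refine Finset.sum_le_sum fun i hi => ?_
        have hw := bumpWeight_nonneg htmono k hi s
        rw [norm_mul, Real.norm_of_nonneg hw]
        by_cases h0 : bumpWeight (t n) k i s = 0
        · simp [h0]
        · obtain ⟨h1, h2⟩ := Finset.mem_Icc.1 hi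
          have hlt := htmono (i - 1) (by omega)
          rw [Nat.sub_add_cancel h1] at hlt
          exact mul_le_mul_of_nonneg_right
            (hx _ _ (abs_sub_le_of_bumpWeight_ne_zero ht0 hmesh hk hi h0 hlt.le)) hw
    _ = r := by rw [← Finset.mul_sum, hsum, mul_one]

lemma norm_discretization_le (hF : ∀ (μ : C(Set.Icc a b, ℝ) →L[ℝ] ℝ) (u : ℝ),
      Tendsto (fun k : ℕ => μ (gbump a b u k)) atTop (𝓝 (F μ u)))
    {t : ℕ → ℕ → Set.Icc a b} {n : ℕ} (hn : 1 ≤ n) (ht0 : (t n 0 : ℝ) = a)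
    (htlast : (t n n : ℝ) = b) (htmono : ∀ i < n, (t n i : ℝ) < (t n (i + 1) : ℝ))
    {δ : ℝ} (hδ : 0 < δ) (hmesh : ∀ i < n, (t n (i + 1) : ℝ) - (t n i : ℝ) ≤ δ)
    (μ : C(Set.Icc a b, ℝ) →L[ℝ] ℝ) : ‖discretization hF t n μ‖ ≤ 3 * ‖μ‖ := by
  refine ContinuousLinearMap.opNorm_le_bound _ (by positivity) fun x => ?_
  have h1 := abs_discretization_sub_le hF hn ht0 htlast htmono hδ hmesh (x := x)
    (r := 2 * ‖x‖) (by positivity) (fun s u _ => by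
      have h2 := x.norm_coe_le_norm s
      have h3 := x.norm_coe_le_norm u
      have h4 := norm_sub_le (x s) (x u)
      rw [← Real.norm_eq_abs]
      linarith) μ
  have h2 := μ.le_opNorm x
  have h3 := norm_add_le (discretization hF t n μ x - μ x) (μ x)
  rw [sub_add_cancel] at h3
  rw [← Real.norm_eq_abs] at h1
  linarith

lemma norm_apply_discretization_sub_le (hF : ∀ (μ : C(Set.Icc a b, ℝ) →L[ℝ] ℝ) (u : ℝ),
      Tendsto (fun k : ℕ => μ (gbump a b u k)) atTop (𝓝 (F μ u)))
    {t : ℕ → ℕ → Set.Icc a b} {n : ℕ} (hn : 1 ≤ n) (ht0 : (t n 0 : ℝ) = a)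
    (htlast : (t n n : ℝ) = b) (htmono : ∀ i < n, (t n i : ℝ) < (t n (i + 1) : ℝ))
    {δ : ℝ} (hδ : 0 < δ) (hmesh : ∀ i < n, (t n (i + 1) : ℝ) - (t n i : ℝ) ≤ δ)
    {K : C(Set.Icc a b × Set.Icc a b, ℝ)} {L : NNReal} (hK : LipschitzWith L fun su => K su)
    {Kop : (C(Set.Icc a b, ℝ) →L[ℝ] ℝ) →L[ℝ] C(Set.Icc a b, ℝ)}
    (hKop : ∀ (μ : C(Set.Icc a b, ℝ) →L[ℝ] ℝ) (s : Set.Icc a b), Kop μ s = μ (K.curry s))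
    (μ : C(Set.Icc a b, ℝ) →L[ℝ] ℝ) :
    ‖Kop (discretization hF t n μ) - Kop μ‖ ≤ L * δ * ‖μ‖ := by
  refine (ContinuousMap.norm_le _ (by positivity)).2 fun s => ?_
  rw [ContinuousMap.sub_apply, hKop, hKop, Real.norm_eq_abs, mul_comm]
  refine abs_discretization_sub_le hF hn ht0 htlast htmono hδ hmesh (by positivity)
    (fun u v huv => ?_) μ
  have h2 := hK.dist_le_mul (s, u) (s, v)
  rw [Prod.dist_eq, dist_self, max_eq_right dist_nonneg, Real.dist_eq] at h2
  exact h2.trans (mul_le_mul_of_nonneg_left huv L.2)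

lemma eventually_abs_discretization_sub_le
    (hF : ∀ (μ : C(Set.Icc a b, ℝ) →L[ℝ] ℝ) (u : ℝ),
      Tendsto (fun k : ℕ => μ (gbump a b u k)) atTop (𝓝 (F μ u)))
    {t : ℕ → ℕ → Set.Icc a b} (ht0 : ∀ n, 1 ≤ n → (t n 0 : ℝ) = a)
    (htlast : ∀ n, 1 ≤ n → (t n n : ℝ) = b)
    (htmono : ∀ n, 1 ≤ n → ∀ i < n, (t n i : ℝ) < (t n (i + 1) : ℝ))
    {δ : ℕ → ℝ} (hδ : Tendsto δ atTop (𝓝 0))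
    (hmesh : ∀ n, 1 ≤ n → ∀ i < n, (t n (i + 1) : ℝ) - (t n i : ℝ) ≤ δ n)
    (z : C(Set.Icc a b, ℝ)) {r : ℝ} (hr : 0 < r) :
    ∀ᶠ n in atTop, ∀ μ : C(Set.Icc a b, ℝ) →L[ℝ] ℝ,
      |discretization hF t n μ z - μ z| ≤ r * ‖μ‖ := by
  have huc := Metric.uniformContinuous_iff.1
    (CompactSpace.uniformContinuous_of_continuous z.continuous)
  obtain ⟨d, hd, hzd⟩ := huc r hr
  filter_upwards [hδ.eventually (gt_mem_nhds (half_pos hd)), eventually_ge_atTop 1]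
    with n hn h1 μ
  rw [mul_comm]
  refine abs_discretization_sub_le hF h1 (ht0 n h1) (htlast n h1) (htmono n h1) (half_pos hd)
    (fun i hi => (hmesh n h1 i hi).trans hn.le) hr.le (fun s u hsu => ?_) μ
  exact (hzd (a := s) (b := u) (lt_of_le_of_lt hsu (half_lt_self hd))).le

end Discretization

/-- In a finite measure space, pointwise convergence along a countably generated filter implies
convergence in measure. -/
lemma tendstoInMeasure_of_tendsto {α ι E : Type*} [MeasurableSpace α] {μ : Measure α}
    [IsFiniteMeasure μ] [PseudoEMetricSpace E] {l : Filter ι} [l.IsCountablyGenerated]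
    {f : ι → α → E} {g : α → E} (hf : ∀ i, AEStronglyMeasurable (f i) μ)
    (hfg : ∀ x, Tendsto (fun i => f i x) l (𝓝 (g x))) : TendstoInMeasure μ f l g := fun ε hε =>
  tendsto_of_seq_tendsto fun u hu =>
    tendstoInMeasure_of_tendsto_ae (fun n => hf (u n))
      (.of_forall fun x => (hfg x).comp hu) ε hε

/-- Corollary 3.24 / `convergent_rate_n_epsilon`.
If `K` is Lipschitz continuous on `T²` and the partitions satisfy
`max_i |tᵢ − tᵢ₋₁| = O(1/n)`, then `ε⁻¹(θ̂_{n,ε} − θ₀) → Σ⁻¹⟨∇μ_{θ₀}, Z⟩` in probability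
as `n → ∞`, `ε → 0` and `nε → ∞`. -/
theorem stmt12 {a b : ℝ} (hab : a < b) {p : ℕ}
    {Ω : Type*} [MeasurableSpace Ω] (P : Measure Ω) [IsProbabilityMeasure P]
    (K : C(Set.Icc a b × Set.Icc a b, ℝ))
    (hKsymm : ∀ s t : Set.Icc a b, K (s, t) = K (t, s))
    (L : NNReal) (hKlip : LipschitzWith L (fun su : Set.Icc a b × Set.Icc a b => K su))
    (Kop : (C(Set.Icc a b, ℝ) →L[ℝ] ℝ) →L[ℝ] C(Set.Icc a b, ℝ))
    (hKop : ∀ (μ : C(Set.Icc a b, ℝ) →L[ℝ] ℝ) (s : Set.Icc a b), Kop μ s = μ (K.curry s))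
    (hpos : ∀ μ : C(Set.Icc a b, ℝ) →L[ℝ] ℝ, 0 ≤ μ (Kop μ))
    (hsym : ∀ μ ν : C(Set.Icc a b, ℝ) →L[ℝ] ℝ, μ (Kop ν) = ν (Kop μ))
    (Z : Ω → C(Set.Icc a b, ℝ))
    (hZmeas : ∀ ν : C(Set.Icc a b, ℝ) →L[ℝ] ℝ, Measurable fun ω => ν (Z ω))
    (hZgauss : ∀ ν : C(Set.Icc a b, ℝ) →L[ℝ] ℝ,
      P.map (fun ω => ν (Z ω)) = gaussianReal 0 (Real.toNNReal (ν (Kop ν))))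
    (hZcov : ∀ μ ν : C(Set.Icc a b, ℝ) →L[ℝ] ℝ,
      ∫ ω, μ (Z ω) * ν (Z ω) ∂P = μ (Kop ν))
    (Θ : Set (EuclideanSpace ℝ (Fin p))) (hΘc : IsCompact Θ) (hΘconv : Convex ℝ Θ)
    (θ₀ : EuclideanSpace ℝ (Fin p)) (hθ₀Θ : θ₀ ∈ Θ) (hθ₀ : θ₀ ∈ interior Θ)
    (μf : EuclideanSpace ℝ (Fin p) → (C(Set.Icc a b, ℝ) →L[ℝ] ℝ))
    (hcont : ContinuousOn μf Θ)
    (hident : ∀ θ ∈ Θ, (∀ s : Set.Icc a b, Kop (μf θ) s = Kop (μf θ₀) s) → θ = θ₀)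
    (Dμ : EuclideanSpace ℝ (Fin p) → Fin p → (C(Set.Icc a b, ℝ) →L[ℝ] ℝ))
    (D2μ : EuclideanSpace ℝ (Fin p) → Fin p → Fin p → (C(Set.Icc a b, ℝ) →L[ℝ] ℝ))
    (hD1 : ∀ θ ∈ Θ, HasFDerivWithinAt μf (clmOfPartials (Dμ θ)) Θ θ)
    (hD2 : ∀ θ ∈ Θ, ∀ i, HasFDerivWithinAt (fun θ' => Dμ θ' i)
      (clmOfPartials (fun j => D2μ θ j i)) Θ θ)
    (hD2cont : UniformContinuousOn D2μ Θ)
    (Sig : Matrix (Fin p) (Fin p) ℝ)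
    (hSigdef : ∀ i j, Sig i j = (Dμ θ₀ i) (Kop (Dμ θ₀ j)))
    (hSiginv : IsUnit Sig.det)
    -- the partitions `0 = t n 0 < t n 1 < ⋯ < t n n = max T` with mesh `O(1/n)`
    (t : ℕ → ℕ → Set.Icc a b)
    (ht0 : ∀ n, 1 ≤ n → (t n 0 : ℝ) = a)
    (htlast : ∀ n, 1 ≤ n → (t n n : ℝ) = b)
    (htmono : ∀ n, 1 ≤ n → ∀ i < n, (t n i : ℝ) < (t n (i + 1) : ℝ))
    (hmesh : ∃ C : ℝ, ∀ n, 1 ≤ n → ∀ i < n, (t n (i + 1) : ℝ) - (t n i : ℝ) ≤ C / n)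
    -- `F μ u = μ([a,u])`, the cumulative distribution function of `μ`
    (F : (C(Set.Icc a b, ℝ) →L[ℝ] ℝ) → ℝ → ℝ)
    (hF : ∀ (μ : C(Set.Icc a b, ℝ) →L[ℝ] ℝ) (u : ℝ),
      Tendsto (fun k : ℕ => μ (gbump a b u k)) atTop (𝓝 (F μ u)))
    -- the discrete M-estimator
    (θhat : ℕ → ℝ → Ω → EuclideanSpace ℝ (Fin p))
    (hθmeas : ∀ n ε, Measurable (θhat n ε))
    (hmem : ∀ n, 1 ≤ n → ∀ ε > (0 : ℝ), ∀ ω, θhat n ε ω ∈ Θ)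
    (hargmax : ∀ n, 1 ≤ n → ∀ ε > (0 : ℝ), ∀ ω, ∀ θ ∈ Θ,
      contrastD F t K n (μf θ) (Kop (μf θ₀) + ε • Z ω) ≤
        contrastD F t K n (μf (θhat n ε ω)) (Kop (μf θ₀) + ε • Z ω)) :
    TendstoInMeasure P
      (fun (q : ℕ × ℝ) (ω : Ω) => fun i : Fin p => (q.2)⁻¹ * (θhat q.1 q.2 ω i - θ₀ i))
      ((atTop ×ˢ 𝓝[>] 0) ⊓ comap (fun q : ℕ × ℝ => (q.1 : ℝ) * q.2) atTop)
      (fun ω => Sig⁻¹.mulVec fun j => (Dμ θ₀ j) (Z ω)) := by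
  obtain ⟨C, hC⟩ := hmesh
  have hC0 : 0 < C := by
    have h1 := hC 1 le_rfl 0 one_pos
    have h2 := htlast 1 le_rfl
    have h3 := ht0 1 le_rfl
    rw [zero_add, h2, h3] at h1
    norm_num at h1
    linarith
  set l : Filter (ℕ × ℝ) :=
    (atTop ×ˢ 𝓝[>] 0) ⊓ comap (fun q : ℕ × ℝ => (q.1 : ℝ) * q.2) atTop with hl
  have hfst : Tendsto (fun q : ℕ × ℝ => q.1) l atTop := tendsto_fst.mono_left inf_le_left
  have hsnd : Tendsto (fun q : ℕ × ℝ => q.2) l (𝓝[>] 0) := tendsto_snd.mono_left inf_le_left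
  have hmul : Tendsto (fun q : ℕ × ℝ => (q.1 : ℝ) * q.2) l atTop :=
    tendsto_comap.mono_left inf_le_right
  have hn : ∀ᶠ q in l, 1 ≤ q.1 := hfst.eventually_ge_atTop 1
  have hε : ∀ᶠ q in l, 0 < q.2 := hsnd.eventually self_mem_nhdsWithin
  refine tendstoInMeasure_of_tendsto (fun q => Measurable.aestronglyMeasurable ?_) fun ω => ?_
  · refine measurable_pi_lambda _ fun i => Measurable.const_mul (Measurable.sub_const ?_ _) _
    exact (EuclideanSpace.proj (𝕜 := ℝ) i).continuous.measurable.comp (hθmeas q.1 q.2)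
  have hmain : Tendsto (fun q : ℕ × ℝ => (q.2)⁻¹ • (θhat q.1 q.2 ω - θ₀)) l
      (𝓝 (WithLp.toLp 2 (Sig⁻¹ *ᵥ fun j => (Dμ θ₀ j) (Z ω)))) := by
    refine tendsto_rescaled_argmax_of_partials (K := Kop)
      (A := fun q : ℕ × ℝ => discretization hF t q.1) (δ := fun q => L * (C / q.1))
      hpos hsym hΘc hθ₀ hD1 (fun i => (hD2 θ₀ hθ₀Θ i).continuousWithinAt) ?_
      (by norm_num : (0 : ℝ) ≤ 3) ?_ hsnd ?_ ?_ ?_ ?_ ?_ ?_ hSigdef hSiginv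
    · exact fun θ hθ h => hident θ hθ fun s => h (ContinuousMap.evalCLM ℝ s)
    · filter_upwards [hn] with q hq
      exact norm_discretization_le hF hq (ht0 _ hq) (htlast _ hq) (htmono _ hq)
        (div_pos hC0 (Nat.cast_pos.2 hq)) (hC _ hq)
    · exact .of_forall fun q => by positivity
    · have hlim : Tendsto (fun q : ℕ × ℝ => L * C * ((q.1 : ℝ) * q.2)⁻¹) l (𝓝 0) := by
        simpa using hmul.inv_tendsto_atTop.const_mul (L * C)
      refine hlim.congr fun q => ?_
      rw [mul_inv]
      ring
    · filter_upwards [hn] with q hq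
      exact norm_apply_discretization_sub_le hF hq (ht0 _ hq) (htlast _ hq) (htmono _ hq)
        (div_pos hC0 (Nat.cast_pos.2 hq)) (hC _ hq) hKlip hKop
    · exact fun r hr => hfst.eventually (eventually_abs_discretization_sub_le hF ht0 htlast htmono
        (tendsto_const_div_atTop_nhds_zero_nat C) hC (Z ω) hr)
    · filter_upwards [hn, hε] with q hq hq2 using hmem _ hq _ hq2 ω
    · filter_upwards [hn, hε] with q hq hq2 θ hθ
      rw [← contrastD_eq hF t q.1 hKop, ← contrastD_eq hF t q.1 hKop]
      exact hargmax _ hq _ hq2 ω θ hθ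
  exact ((PiLp.continuous_ofLp 2 _).tendsto _).comp hmain
end
end

section
/- Coercive property: there exists a constant c > 0 such that for all θ ∈ Θ, ⟨μ_θ − μ_{θ₀}, 𝒦(μ_θ − μ_{θ₀})⟩ ≥ c|θ − θ₀|² and ⟨μ_θ − μ_{θ₀}, 𝒦(μ_θ − μ_{θ₀})⟩ ≥ c‖μ_θ − μ_{θ₀}‖²_{TV}, where ‖·‖_{TV} is the total variation norm. -/
open Filter MeasureTheory ProbabilityTheory Topology Matrix

noncomputable section

/-- A symmetric positive-semidefinite operator `K : X* → X` kills every null vector of its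
quadratic form. -/
lemma eq_zero_of_apply_self_eq_zero {X : Type*} [NormedAddCommGroup X] [NormedSpace ℝ X]
    (K : (X →L[ℝ] ℝ) →L[ℝ] X) (hpos : ∀ μ : X →L[ℝ] ℝ, 0 ≤ μ (K μ))
    (hsym : ∀ μ ν : X →L[ℝ] ℝ, μ (K ν) = ν (K μ))
    {μ : X →L[ℝ] ℝ} (hμ : μ (K μ) = 0) : K μ = 0 := by
  refine SeparatingDual.eq_zero_of_forall_dual_eq_zero (R := ℝ) fun ν => ?_
  have h : ∀ t : ℝ, 0 ≤ 0 * (t * t) + 2 * ν (K μ) * t + ν (K ν) := fun t => by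
    have := hpos (ν + t • μ)
    simp only [map_add, map_smul, _root_.add_apply, _root_.smul_apply,
      smul_eq_mul, hμ, hsym μ ν] at this
    linarith
  have := discrim_le_zero h
  rw [discrim] at this
  nlinarith [sq_nonneg (ν (K μ))]

/-- A local bound `G ≤ C * F` at the only possible zero of `F` on a compact set globalises. -/
lemma exists_pos_mul_le_of_eventually {Y : Type*} [TopologicalSpace Y] {S : Set Y}
    (hS : IsCompact S) {F G : Y → ℝ} {y₀ : Y} (hF : ContinuousOn F S) (hG : ContinuousOn G S)
    (hF0 : ∀ y ∈ S, 0 ≤ F y) (hFpos : ∀ y ∈ S, y ≠ y₀ → 0 < F y) {c : ℝ} (hc : 0 < c)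
    (hloc : ∀ᶠ y in 𝓝[S] y₀, c * G y ≤ F y) :
    ∃ c' > (0 : ℝ), ∀ y ∈ S, c' * G y ≤ F y := by
  obtain ⟨U, hU, hyU, hUS⟩ := mem_nhdsWithin.1 hloc
  have hT : IsCompact (S \ U) := hS.diff hU
  obtain ⟨m, hm, hmF⟩ := hT.exists_forall_le' (hF.mono Set.sdiff_subset) (a := 0)
    fun y hy => hFpos y hy.1 (by rintro rfl; exact hy.2 hyU)
  obtain ⟨M, hM⟩ := hT.bddAbove_image (hG.mono Set.sdiff_subset)
  have hM' : 0 < |M| + 1 := by positivity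
  have hd : 0 < m / (|M| + 1) := by positivity
  refine ⟨min c (m / (|M| + 1)), lt_min hc hd, fun y hy => ?_⟩
  rcases le_or_gt (G y) 0 with h0 | h0
  · exact (mul_nonpos_of_nonneg_of_nonpos (lt_min hc hd).le h0).trans (hF0 y hy)
  by_cases hyU' : y ∈ U
  · exact (mul_le_mul_of_nonneg_right (min_le_left _ _) h0.le).trans (hUS ⟨hyU', hy⟩)
  · calc min c (m / (|M| + 1)) * G y ≤ m / (|M| + 1) * (|M| + 1) := by
          refine mul_le_mul (min_le_right _ _) ?_ h0.le hd.le
          linarith [hM (Set.mem_image_of_mem G ⟨hy, hyU'⟩), le_abs_self M]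
      _ = m := div_mul_cancel₀ _ hM'.ne'
      _ ≤ F y := hmF y ⟨hy, hyU'⟩

/-- A positive function, homogeneous of degree two, on a finite-dimensional space is bounded
below by a multiple of the squared norm. -/
lemma exists_pos_mul_sq_norm_le {E : Type*} [NormedAddCommGroup E] [NormedSpace ℝ E]
    [FiniteDimensional ℝ E] {q : E → ℝ} (hq : Continuous q)
    (hsmul : ∀ (t : ℝ) (h : E), q (t • h) = t ^ 2 * q h) (hpos : ∀ h, h ≠ 0 → 0 < q h) :
    ∃ c > (0 : ℝ), ∀ h, c * ‖h‖ ^ 2 ≤ q h := by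
  have : ProperSpace E := FiniteDimensional.proper_real E
  obtain ⟨c, hc, hcq⟩ := (isCompact_sphere (0 : E) 1).exists_forall_le' hq.continuousOn (a := 0)
    fun h hh => hpos h (ne_zero_of_mem_unit_sphere ⟨h, hh⟩)
  refine ⟨c, hc, fun h => ?_⟩
  rcases eq_or_ne h 0 with rfl | hh
  · have := hsmul 0 0
    simp_all
  · have hn : 0 < ‖h‖ := norm_pos_iff.2 hh
    have h1 := hcq (‖h‖⁻¹ • h) (by simp [norm_smul, hn.ne'])
    rw [hsmul, inv_pow, inv_mul_eq_div, le_div_iff₀ (by positivity)] at h1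
    exact h1

/-- If `f` has derivative `L` within `S` at `x₀` and the quadratic form of `K` is coercive along
`L`, then it dominates the squared increments of `f` and of the variable near `x₀`. -/
lemma eventually_mul_le_apply_self {E X : Type*} [NormedAddCommGroup E] [NormedSpace ℝ E]
    [NormedAddCommGroup X] [NormedSpace ℝ X]
    (K : (X →L[ℝ] ℝ) →L[ℝ] X) (hpos : ∀ μ : X →L[ℝ] ℝ, 0 ≤ μ (K μ))
    (hsym : ∀ μ ν : X →L[ℝ] ℝ, μ (K ν) = ν (K μ))
    {S : Set E} {x₀ : E} {f : E → (X →L[ℝ] ℝ)} {L : E →L[ℝ] (X →L[ℝ] ℝ)}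
    (hf : HasFDerivWithinAt f L S x₀) {c : ℝ} (hc : 0 < c)
    (hL : ∀ h, c * ‖h‖ ^ 2 ≤ L h (K (L h))) :
    ∃ d > (0 : ℝ), ∀ᶠ x in 𝓝[S] x₀,
      d * (‖x - x₀‖ ^ 2 + ‖f x - f x₀‖ ^ 2) ≤ (f x - f x₀) (K (f x - f x₀)) := by
  set A : ℝ := ‖K‖ * ‖L‖ with hA
  have hA0 : 0 ≤ A := by positivity
  set ε : ℝ := c / (4 * (A + 1)) with hε
  have hε0 : 0 < ε := by positivity
  have hεA : 2 * ε * A ≤ c / 2 := by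
    have : ε * (4 * (A + 1)) = c := div_mul_cancel₀ _ (by positivity)
    nlinarith
  refine ⟨c / 2 / (1 + (‖L‖ + ε) ^ 2), by positivity, ?_⟩
  filter_upwards [hf.isLittleO.def hε0] with x hx
  set h := x - x₀ with hh
  set r := f x - f x₀ - L h with hr
  have hfx : f x - f x₀ = L h + r := by rw [hr]; abel
  have hnorm : ‖f x - f x₀‖ ≤ (‖L‖ + ε) * ‖h‖ := by
    rw [hfx, add_mul]
    exact (norm_add_le _ _).trans (add_le_add (L.le_opNorm h) hx)
  have hcross : |r (K (L h))| ≤ ε * A * ‖h‖ ^ 2 := by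
    calc |r (K (L h))| ≤ ‖r‖ * ‖K (L h)‖ := r.le_opNorm _
      _ ≤ (ε * ‖h‖) * (‖K‖ * (‖L‖ * ‖h‖)) := by
          gcongr
          exact (K.le_opNorm _).trans (by gcongr; exact L.le_opNorm h)
      _ = ε * A * ‖h‖ ^ 2 := by rw [hA]; ring
  have hlow : c / 2 * ‖h‖ ^ 2 ≤ (f x - f x₀) (K (f x - f x₀)) := by
    rw [hfx]
    simp only [map_add, _root_.add_apply]
    rw [hsym (L h) r]
    have h1 := mul_le_mul_of_nonneg_right hεA (sq_nonneg ‖h‖)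
    linarith [hL h, hpos r, neg_abs_le (r (K (L h)))]
  refine le_trans ?_ hlow
  rw [div_mul_eq_mul_div, div_le_iff₀ (by positivity)]
  have h2 : ‖f x - f x₀‖ ^ 2 ≤ (‖L‖ + ε) ^ 2 * ‖h‖ ^ 2 := by
    rw [← mul_pow]; gcongr
  rw [mul_assoc]
  gcongr
  linarith

/-- Coercivity on a compact set of the quadratic form of `K` along increments of `f` from `x₀`,
from identifiability and nondegeneracy of the form along the derivative at `x₀`. -/
lemma exists_pos_forall_mul_le_apply_self {E X : Type*} [NormedAddCommGroup E] [NormedSpace ℝ E]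
    [FiniteDimensional ℝ E] [NormedAddCommGroup X] [NormedSpace ℝ X]
    (K : (X →L[ℝ] ℝ) →L[ℝ] X) (hpos : ∀ μ : X →L[ℝ] ℝ, 0 ≤ μ (K μ))
    (hsym : ∀ μ ν : X →L[ℝ] ℝ, μ (K ν) = ν (K μ))
    {S : Set E} (hS : IsCompact S) {x₀ : E} {f : E → (X →L[ℝ] ℝ)} (hf : ContinuousOn f S)
    (hident : ∀ x ∈ S, K (f x) = K (f x₀) → x = x₀)
    {L : E →L[ℝ] (X →L[ℝ] ℝ)} (hfL : HasFDerivWithinAt f L S x₀)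
    (hL : ∀ h, K (L h) = 0 → h = 0) :
    ∃ c > (0 : ℝ), ∀ x ∈ S,
      c * (‖x - x₀‖ ^ 2 + ‖f x - f x₀‖ ^ 2) ≤ (f x - f x₀) (K (f x - f x₀)) := by
  obtain ⟨c₀, hc₀, hc₀L⟩ := exists_pos_mul_sq_norm_le (q := fun h => L h (K (L h)))
    (L.continuous.clm_apply (K.continuous.comp L.continuous))
    (fun t h => by simp only [map_smul, _root_.smul_apply, smul_eq_mul]; ring)
    (fun h hh => (hpos _).lt_of_ne' fun h0 =>
      hh (hL h (eq_zero_of_apply_self_eq_zero K hpos hsym h0)))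
  obtain ⟨d, hd, hloc⟩ := eventually_mul_le_apply_self K hpos hsym hfL hc₀ hc₀L
  have hdiff : ContinuousOn (fun x => f x - f x₀) S := hf.sub continuousOn_const
  refine exists_pos_mul_le_of_eventually hS (y₀ := x₀)
    (hdiff.clm_apply (K.continuous.comp_continuousOn hdiff))
    (((continuousOn_id.sub continuousOn_const).norm.pow 2).add (hdiff.norm.pow 2))
    (fun x _ => hpos _)
    (fun x hx hne => (hpos _).lt_of_ne' fun h0 => hne <| hident x hx ?_) hd hloc
  rw [← sub_eq_zero, ← map_sub]
  exact eq_zero_of_apply_self_eq_zero K hpos hsym h0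

/-- Evaluating the derivative built from the partial derivatives `v i`. -/
lemma clmOfPartials_apply {a b : ℝ} {p : ℕ} (v : Fin p → (C(Set.Icc a b, ℝ) →L[ℝ] ℝ))
    (h : EuclideanSpace ℝ (Fin p)) (x : C(Set.Icc a b, ℝ)) :
    clmOfPartials v h x = ∑ i, h i * v i x := by
  simp [clmOfPartials, _root_.sum_apply]

/-- Proposition 3.25, coercive property.
Under compactness and convexity of `Θ`, interiority of `θ₀`, continuity of `θ ↦ μ_θ`,
identifiability, `C²`-regularity and invertibility of
`Σᵢⱼ = ⟨∂ᵢμ_{θ₀}, 𝒦∂ⱼμ_{θ₀}⟩`, there is a constant `c > 0` such that for all `θ ∈ Θ`,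
`⟨μ_θ − μ_{θ₀}, 𝒦(μ_θ − μ_{θ₀})⟩ ≥ c|θ − θ₀|²` and
`⟨μ_θ − μ_{θ₀}, 𝒦(μ_θ − μ_{θ₀})⟩ ≥ c‖μ_θ − μ_{θ₀}‖²_{TV}`. -/
theorem stmt13 {a b : ℝ} (hab : a < b) {p : ℕ}
    (K : C(Set.Icc a b × Set.Icc a b, ℝ))
    (hKsymm : ∀ s t : Set.Icc a b, K (s, t) = K (t, s))
    (Kop : (C(Set.Icc a b, ℝ) →L[ℝ] ℝ) →L[ℝ] C(Set.Icc a b, ℝ))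
    (hKop : ∀ (μ : C(Set.Icc a b, ℝ) →L[ℝ] ℝ) (s : Set.Icc a b), Kop μ s = μ (K.curry s))
    (hpos : ∀ μ : C(Set.Icc a b, ℝ) →L[ℝ] ℝ, 0 ≤ μ (Kop μ))
    (hsym : ∀ μ ν : C(Set.Icc a b, ℝ) →L[ℝ] ℝ, μ (Kop ν) = ν (Kop μ))
    (Θ : Set (EuclideanSpace ℝ (Fin p))) (hΘc : IsCompact Θ) (hΘconv : Convex ℝ Θ)
    (θ₀ : EuclideanSpace ℝ (Fin p)) (hθ₀Θ : θ₀ ∈ Θ) (hθ₀ : θ₀ ∈ interior Θ)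
    (μf : EuclideanSpace ℝ (Fin p) → (C(Set.Icc a b, ℝ) →L[ℝ] ℝ))
    (hcont : ContinuousOn μf Θ)
    (hident : ∀ θ ∈ Θ, (∀ s : Set.Icc a b, Kop (μf θ) s = Kop (μf θ₀) s) → θ = θ₀)
    (Dμ : EuclideanSpace ℝ (Fin p) → Fin p → (C(Set.Icc a b, ℝ) →L[ℝ] ℝ))
    (D2μ : EuclideanSpace ℝ (Fin p) → Fin p → Fin p → (C(Set.Icc a b, ℝ) →L[ℝ] ℝ))
    (hD1 : ∀ θ ∈ Θ, HasFDerivWithinAt μf (clmOfPartials (Dμ θ)) Θ θ)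
    (hD2 : ∀ θ ∈ Θ, ∀ i, HasFDerivWithinAt (fun θ' => Dμ θ' i)
      (clmOfPartials (fun j => D2μ θ j i)) Θ θ)
    (hD2cont : UniformContinuousOn D2μ Θ)
    (Sig : Matrix (Fin p) (Fin p) ℝ)
    (hSigdef : ∀ i j, Sig i j = (Dμ θ₀ i) (Kop (Dμ θ₀ j)))
    (hSiginv : IsUnit Sig.det) :
    ∃ c > (0 : ℝ), ∀ θ ∈ Θ,
      c * ‖θ - θ₀‖ ^ 2 ≤ (μf θ - μf θ₀) (Kop (μf θ - μf θ₀)) ∧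
        c * ‖μf θ - μf θ₀‖ ^ 2 ≤ (μf θ - μf θ₀) (Kop (μf θ - μf θ₀)) := by
  have hL : ∀ h, Kop (clmOfPartials (Dμ θ₀) h) = 0 → h = 0 := by
    intro h hK
    have hS : Sig *ᵥ h.ofLp = 0 := by
      ext i
      have h0 : clmOfPartials (Dμ θ₀) h (Kop (Dμ θ₀ i)) = 0 := by rw [hsym, hK, map_zero]
      rw [clmOfPartials_apply] at h0
      rw [Pi.zero_apply, ← h0, Matrix.mulVec, dotProduct]
      exact Finset.sum_congr rfl fun j _ => by rw [hSigdef, hsym, mul_comm]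
    ext i
    exact congrFun (Matrix.eq_zero_of_mulVec_eq_zero hSiginv.ne_zero hS) i
  obtain ⟨c, hc, hcF⟩ := exists_pos_forall_mul_le_apply_self Kop hpos hsym hΘc hcont
    (fun θ hθ hK => hident θ hθ fun s => by rw [hK]) (hD1 θ₀ hθ₀Θ) hL
  refine ⟨c, hc, fun θ hθ => ⟨le_trans ?_ (hcF θ hθ), le_trans ?_ (hcF θ hθ)⟩⟩
  · exact mul_le_mul_of_nonneg_left (le_add_of_nonneg_right (sq_nonneg _)) hc.le
  · exact mul_le_mul_of_nonneg_left (le_add_of_nonneg_left (sq_nonneg _)) hc.le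
end
end
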